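/- Assume η ∈ P(b,ε) and ε ≥ 0 elementwise, and suppose σ, σ' ∈ ℝ^m with σ, σ' ≥ 0 attain the supremum of the dual objective (σ'−σ)·b − (σ'+σ)·ε − Σ_i log( Σ_ℓ exp(a^{(σ'−σ)}_{iℓ}) ) over all pairs of nonnegative vectors. Then the softmax prediction g^{(σ'−σ)} is an optimal learner play: inf_{z ∈ P(b,ε)} z·log g^{(σ'−σ)} = inf_{z ∈ P(b,ε)} z·log z = sup_{g ∈ Δ_k^n} inf_{z ∈ P(b,ε)} z·log g. -/

import Mathlib

open Finset

attribute [local instance] Classical.propDecidable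

noncomputable section

/-- The simplex `Δ_k^n`: rows are probability distributions over `Fin k`. -/
def Simplex (n k : ℕ) : Set (Fin n → Fin k → ℝ) :=
  {z | (∀ i ℓ, 0 ≤ z i ℓ) ∧ ∀ i, ∑ ℓ, z i ℓ = 1}

/-- Number of points where rule `j` does not abstain. -/
def nRule {n k p : ℕ} (h : Fin p → Fin n → Option (Fin k)) (j : Fin p) : ℕ :=
  (Finset.univ.filter (fun i => h j i ≠ none)).card

/-- The constraint matrix `A`, with `m = p + k` rows indexed by `Fin p ⊕ Fin k`. -/
def Amat {n k p : ℕ} (h : Fin p → Fin n → Option (Fin k)) :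
    Fin p ⊕ Fin k → Fin n → Fin k → ℝ
  | Sum.inl j => fun i ℓ => if h j i = some ℓ then 1 / (nRule h j : ℝ) else 0
  | Sum.inr ℓ' => fun i ℓ => if ℓ = ℓ' then 1 / (n : ℝ) else 0

/-- `(A z)_j`. -/
def applyA {n k p : ℕ} (h : Fin p → Fin n → Option (Fin k))
    (z : Fin n → Fin k → ℝ) (j : Fin p ⊕ Fin k) : ℝ :=
  ∑ i, ∑ ℓ, Amat h j i ℓ * z i ℓ

/-- The polytope `P(b, ε)`. -/
def Polytope {n k p : ℕ} (h : Fin p → Fin n → Option (Fin k))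
    (b ε : Fin p ⊕ Fin k → ℝ) : Set (Fin n → Fin k → ℝ) :=
  {z | z ∈ Simplex n k ∧ ∀ j, b j - ε j ≤ applyA h z j ∧ applyA h z j ≤ b j + ε j}

/-- Extended-real logarithm, with `elog 0 = ⊥ = -∞`. -/
def elog (x : ℝ) : EReal := if x = 0 then ⊥ else ((Real.log x : ℝ) : EReal)

/-- `z · log g`, valued in `[-∞, 0]` with the convention `0 · log 0 = 0`. -/
def dotlog {n k : ℕ} (z g : Fin n → Fin k → ℝ) : EReal :=
  ∑ i, ∑ ℓ, (z i ℓ : EReal) * elog (g i ℓ)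

/-- `a^{(θ)}_{iℓ} = Σ_j θ_j · A j i ℓ`. -/
def avec {n k p : ℕ} (h : Fin p → Fin n → Option (Fin k))
    (θ : Fin p ⊕ Fin k → ℝ) (i : Fin n) (ℓ : Fin k) : ℝ :=
  ∑ j, θ j * Amat h j i ℓ

/-- The exponential-family (softmax) prediction `g^{(θ)}`. -/
def gexp {n k p : ℕ} (h : Fin p → Fin n → Option (Fin k))
    (θ : Fin p ⊕ Fin k → ℝ) (i : Fin n) (ℓ : Fin k) : ℝ :=
  Real.exp (avec h θ i ℓ) / ∑ ℓ', Real.exp (avec h θ i ℓ')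

/-- The BF dual objective `(σ'−σ)·b − (σ'+σ)·ε − Σ_i log(Σ_ℓ exp(a^{(σ'−σ)}_{iℓ}))`. -/
def dualObj {n k p : ℕ} (h : Fin p → Fin n → Option (Fin k))
    (b ε σ σ' : Fin p ⊕ Fin k → ℝ) : ℝ :=
  (∑ j, (σ' j - σ j) * b j) - (∑ j, (σ' j + σ j) * ε j)
    - ∑ i, Real.log (∑ ℓ, Real.exp (avec h (fun j => σ' j - σ j) i ℓ))

/-- KL summand `a·log(a/c)`, with `0·log(0/c) = 0` and `a·log(a/0) = ⊤` for `a ≠ 0`. -/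
def klTerm (a c : ℝ) : EReal :=
  if a = 0 then 0 else if c = 0 then ⊤ else ((a * Real.log (a / c) : ℝ) : EReal)

/-- `d(μ, ν)`, the summed KL divergences, valued in `[0, +∞]`. -/
def dKL {n k : ℕ} (μ ν : Fin n → Fin k → ℝ) : EReal :=
  ∑ i, ∑ ℓ, klTerm (μ i ℓ) (ν i ℓ)

/-- Unnormalized one-coin Dawid–Skene score `N_{iℓ}`. -/
def Nds {n k p : ℕ} (h : Fin p → Fin n → Option (Fin k))
    (w : Fin k → ℝ) (β : Fin p → ℝ) (i : Fin n) (ℓ : Fin k) : ℝ :=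
  w ℓ * (∏ j ∈ Finset.univ.filter (fun j => h j i = some ℓ), β j)
    * ∏ j ∈ Finset.univ.filter (fun j => ∃ ℓ' ≠ ℓ, h j i = some ℓ'),
        (1 - β j) / ((k : ℝ) - 1)

/-- The one-coin Dawid–Skene prediction `g^{ds}(w, β)`. -/
def gds {n k p : ℕ} (h : Fin p → Fin n → Option (Fin k))
    (w : Fin k → ℝ) (β : Fin p → ℝ) (i : Fin n) (ℓ : Fin k) : ℝ :=
  Nds h w β i ℓ / ∑ ℓ', Nds h w β i ℓ'

lemma coe_finset_sum {ι : Type*} (s : Finset ι) (f : ι → ℝ) :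
    ((∑ i ∈ s, f i : ℝ) : EReal) = ∑ i ∈ s, (f i : EReal) :=
  map_sum (⟨⟨Real.toEReal, EReal.coe_zero⟩, EReal.coe_add⟩ : ℝ →+ EReal) f s

/-- Entropy terms are finite: `x * elog x` is the real number `x * log x`. -/
lemma coe_mul_elog_self (x : ℝ) : (x : EReal) * elog x = ((x * Real.log x : ℝ) : EReal) := by
  unfold elog
  split_ifs with hx
  · simp [hx]
  · rw [EReal.coe_mul]

lemma dotlog_self {n k : ℕ} (z : Fin n → Fin k → ℝ) :
    dotlog z z = ((∑ i, ∑ ℓ, z i ℓ * Real.log (z i ℓ) : ℝ) : EReal) := by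
  simp only [dotlog, coe_mul_elog_self, coe_finset_sum]

lemma dotlog_of_pos {n k : ℕ} (z : Fin n → Fin k → ℝ) {g : Fin n → Fin k → ℝ}
    (hg : ∀ i ℓ, 0 < g i ℓ) :
    dotlog z g = ((∑ i, ∑ ℓ, z i ℓ * Real.log (g i ℓ) : ℝ) : EReal) := by
  simp only [dotlog, elog, (hg _ _).ne', if_false, coe_finset_sum, EReal.coe_mul]

lemma coe_mul_elog_le {x y : ℝ} (hx : 0 ≤ x) (hy : 0 ≤ y) :
    (x : EReal) * elog y ≤ ((x * Real.log x + (y - x) : ℝ) : EReal) := by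
  rcases hx.eq_or_lt with rfl | hx
  · simpa using hy
  rcases hy.eq_or_lt with rfl | hy
  · simp [elog, EReal.coe_mul_bot_of_pos hx]
  · rw [elog, if_neg hy.ne', ← EReal.coe_mul, EReal.coe_le_coe_iff]
    have h1 := Real.log_le_sub_one_of_pos (div_pos hy hx)
    rw [Real.log_div hy.ne' hx.ne'] at h1
    have h2 := mul_le_mul_of_nonneg_left h1 hx.le
    have h3 : x * (y / x - 1) = y - x := by field_simp
    linarith

/-- Gibbs' inequality. -/
lemma dotlog_le_dotlog_self {n k : ℕ} {z g : Fin n → Fin k → ℝ}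
    (hz : z ∈ Simplex n k) (hg : g ∈ Simplex n k) : dotlog z g ≤ dotlog z z := by
  calc dotlog z g
      ≤ ∑ i, ∑ ℓ, ((z i ℓ * Real.log (z i ℓ) + (g i ℓ - z i ℓ) : ℝ) : EReal) :=
        Finset.sum_le_sum fun i _ => Finset.sum_le_sum fun ℓ _ =>
          coe_mul_elog_le (hz.1 i ℓ) (hg.1 i ℓ)
    _ = dotlog z z := by
        rw [dotlog_self]
        simp only [← coe_finset_sum]
        simp [Finset.sum_add_distrib, hz.2, hg.2]

lemma sum_exp_avec_pos {n k p : ℕ} (hk : 0 < k) (h : Fin p → Fin n → Option (Fin k))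
    (θ : Fin p ⊕ Fin k → ℝ) (i : Fin n) : 0 < ∑ ℓ, Real.exp (avec h θ i ℓ) :=
  Finset.sum_pos (fun _ _ => Real.exp_pos _) ⟨⟨0, hk⟩, Finset.mem_univ _⟩

lemma gexp_pos {n k p : ℕ} (hk : 0 < k) (h : Fin p → Fin n → Option (Fin k))
    (θ : Fin p ⊕ Fin k → ℝ) (i : Fin n) (ℓ : Fin k) : 0 < gexp h θ i ℓ :=
  div_pos (Real.exp_pos _) (sum_exp_avec_pos hk h θ i)

lemma gexp_mem_simplex {n k p : ℕ} (hk : 0 < k) (h : Fin p → Fin n → Option (Fin k))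
    (θ : Fin p ⊕ Fin k → ℝ) : gexp h θ ∈ Simplex n k := by
  refine ⟨fun i ℓ => (gexp_pos hk h θ i ℓ).le, fun i => ?_⟩
  simp only [gexp, ← Finset.sum_div]
  exact div_self (sum_exp_avec_pos hk h θ i).ne'

/-- `a^{(θ)} · z = θ · (A z)`. -/
lemma sum_avec_mul {n k p : ℕ} (h : Fin p → Fin n → Option (Fin k))
    (θ : Fin p ⊕ Fin k → ℝ) (z : Fin n → Fin k → ℝ) :
    ∑ i, ∑ ℓ, avec h θ i ℓ * z i ℓ = ∑ j, θ j * applyA h z j := by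
  simp only [avec, applyA, Finset.sum_mul, Finset.mul_sum]
  rw [Finset.sum_comm' (t' := univ) (s' := fun _ => univ) (by simp)]
  simp only [mul_assoc]
  conv_rhs => rw [Finset.sum_comm]
  rw [Finset.sum_comm]
  refine Finset.sum_congr rfl fun i _ => ?_
  rw [Finset.sum_comm]

lemma dotlog_gexp {n k p : ℕ} (hk : 0 < k) (h : Fin p → Fin n → Option (Fin k))
    (θ : Fin p ⊕ Fin k → ℝ) {z : Fin n → Fin k → ℝ} (hz : z ∈ Simplex n k) :
    dotlog z (gexp h θ) = ((∑ j, θ j * applyA h z j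
      - ∑ i, Real.log (∑ ℓ, Real.exp (avec h θ i ℓ)) : ℝ) : EReal) := by
  rw [dotlog_of_pos z (gexp_pos hk h θ), EReal.coe_eq_coe_iff, ← sum_avec_mul,
    ← Finset.sum_sub_distrib]
  refine Finset.sum_congr rfl fun i _ => ?_
  have hlog : ∀ ℓ, Real.log (gexp h θ i ℓ)
      = avec h θ i ℓ - Real.log (∑ ℓ', Real.exp (avec h θ i ℓ')) := fun ℓ => by
    rw [gexp, Real.log_div (Real.exp_pos _).ne' (sum_exp_avec_pos hk h θ i).ne', Real.log_exp]
  simp only [hlog, mul_sub, Finset.sum_sub_distrib, ← Finset.sum_mul, hz.2 i, one_mul]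
  simp only [mul_comm]

lemma hasDerivAt_log_sum_exp {k : ℕ} (hk : 0 < k) (a c : Fin k → ℝ) :
    HasDerivAt (fun t : ℝ => Real.log (∑ ℓ, Real.exp (a ℓ + t * c ℓ)))
      (∑ ℓ, c ℓ * (Real.exp (a ℓ) / ∑ ℓ', Real.exp (a ℓ'))) 0 := by
  have hpos : 0 < ∑ ℓ, Real.exp (a ℓ + 0 * c ℓ) :=
    Finset.sum_pos (fun _ _ => Real.exp_pos _) ⟨⟨0, hk⟩, Finset.mem_univ _⟩
  have hsum : HasDerivAt (fun t : ℝ => ∑ ℓ, Real.exp (a ℓ + t * c ℓ))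
      (∑ ℓ, Real.exp (a ℓ + 0 * c ℓ) * (1 * c ℓ)) 0 :=
    HasDerivAt.fun_sum fun ℓ _ => (((hasDerivAt_id (0 : ℝ)).mul_const (c ℓ)).const_add (a ℓ)).exp
  convert hsum.log hpos.ne' using 1
  simp only [zero_mul, add_zero, one_mul, Finset.sum_div]
  exact Finset.sum_congr rfl fun ℓ _ => by ring

lemma avec_add_mul {n k p : ℕ} (h : Fin p → Fin n → Option (Fin k))
    (σ σ' d d' : Fin p ⊕ Fin k → ℝ) (t : ℝ) (i : Fin n) (ℓ : Fin k) :
    avec h (fun j => (σ' j + t * d' j) - (σ j + t * d j)) i ℓ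
      = avec h (fun j => σ' j - σ j) i ℓ + t * avec h (fun j => d' j - d j) i ℓ := by
  simp only [avec, Finset.mul_sum, ← Finset.sum_add_distrib]
  exact Finset.sum_congr rfl fun j _ => by ring

/-- The directional derivative of the dual objective. -/
lemma hasDerivAt_dualObj {n k p : ℕ} (hk : 0 < k) (h : Fin p → Fin n → Option (Fin k))
    (b ε σ σ' d d' : Fin p ⊕ Fin k → ℝ) :
    HasDerivAt (fun t : ℝ => dualObj h b ε (fun j => σ j + t * d j) (fun j => σ' j + t * d' j))
      (∑ j, (d' j - d j) * b j - ∑ j, (d' j + d j) * ε j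
        - ∑ j, (d' j - d j) * applyA h (gexp h (fun j => σ' j - σ j)) j) 0 := by
  have hlin : ∀ s s' : ℝ, HasDerivAt (fun t : ℝ => s' + t * s) s 0 := fun s s' => by
    simpa using ((hasDerivAt_id (0 : ℝ)).mul_const s).const_add s'
  rw [← sum_avec_mul]
  simp only [dualObj, avec_add_mul]
  refine ((HasDerivAt.fun_sum fun j _ => ?_).sub (HasDerivAt.fun_sum fun j _ => ?_)).sub
    (HasDerivAt.fun_sum fun i _ => hasDerivAt_log_sum_exp hk _ _)
  · exact ((hlin _ _).sub (hlin _ _)).mul_const _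
  · exact ((hlin _ _).add (hlin _ _)).mul_const _

lemma HasDerivAt.nonpos_of_forall_le {f : ℝ → ℝ} {f' : ℝ} (hf : HasDerivAt f f' 0)
    (hle : ∀ t, 0 < t → t ≤ 1 → f t ≤ f 0) : f' ≤ 0 := by
  have hlim := (hasDerivWithinAt_iff_tendsto_slope' (by simp)).1
    (hf.hasDerivWithinAt (s := Set.Ioi 0))
  refine le_of_tendsto hlim ?_
  filter_upwards [Ioc_mem_nhdsGT (zero_lt_one (α := ℝ))] with t ht
  rw [slope_def_field, sub_zero]
  exact div_nonpos_of_nonpos_of_nonneg (sub_nonpos.2 (hle t ht.1 ht.2)) ht.1.le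

/-- First-order optimality of a dual maximizer along feasible directions. -/
lemma dualObj_first_order {n k p : ℕ} (hk : 0 < k) (h : Fin p → Fin n → Option (Fin k))
    (b ε : Fin p ⊕ Fin k → ℝ)
    (σ σ' : Fin p ⊕ Fin k → ℝ) (hσ : ∀ j, 0 ≤ σ j) (hσ' : ∀ j, 0 ≤ σ' j)
    (hopt : ∀ τ τ' : Fin p ⊕ Fin k → ℝ, (∀ j, 0 ≤ τ j) → (∀ j, 0 ≤ τ' j) →
      dualObj h b ε τ τ' ≤ dualObj h b ε σ σ')
    (d d' : Fin p ⊕ Fin k → ℝ) (hd : ∀ j, 0 ≤ σ j + d j) (hd' : ∀ j, 0 ≤ σ' j + d' j) :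
    ∑ j, (d' j - d j) * b j - ∑ j, (d' j + d j) * ε j
      ≤ ∑ j, (d' j - d j) * applyA h (gexp h (fun j => σ' j - σ j)) j := by
  have hconv : ∀ s e t : ℝ, 0 ≤ s → 0 ≤ s + e → 0 < t → t ≤ 1 → 0 ≤ s + t * e := by
    intro s e t hs he ht ht1
    have h1 := mul_nonneg ht.le he
    have h2 := mul_nonneg (sub_nonneg.2 ht1) hs
    linarith
  refine sub_nonpos.1 ((hasDerivAt_dualObj hk h b ε σ σ' d d').nonpos_of_forall_le
    fun t ht ht1 => ?_)
  simp only [zero_mul, add_zero]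
  exact hopt _ _ (fun j => hconv _ _ _ (hσ j) (hd j) ht ht1)
    (fun j => hconv _ _ _ (hσ' j) (hd' j) ht ht1)

/-- The softmax prediction at a dual maximizer satisfies the constraints. -/
lemma gexp_mem_polytope {n k p : ℕ} (hk : 0 < k) (h : Fin p → Fin n → Option (Fin k))
    (b ε : Fin p ⊕ Fin k → ℝ)
    (σ σ' : Fin p ⊕ Fin k → ℝ) (hσ : ∀ j, 0 ≤ σ j) (hσ' : ∀ j, 0 ≤ σ' j)
    (hopt : ∀ τ τ' : Fin p ⊕ Fin k → ℝ, (∀ j, 0 ≤ τ j) → (∀ j, 0 ≤ τ' j) →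
      dualObj h b ε τ τ' ≤ dualObj h b ε σ σ') :
    gexp h (fun j => σ' j - σ j) ∈ Polytope h b ε := by
  have hfirst := dualObj_first_order hk h b ε σ σ' hσ hσ' hopt
  have hsingle : ∀ j j', (0 : ℝ) ≤ (Pi.single j 1 : Fin p ⊕ Fin k → ℝ) j' := fun j j' => by
    rw [Pi.single_apply]; split_ifs <;> norm_num
  refine ⟨gexp_mem_simplex hk h _, fun j => ⟨?_, ?_⟩⟩
  · have := hfirst 0 (Pi.single j 1) (fun j' => by simpa using hσ j')
      (fun j' => add_nonneg (hσ' j') (hsingle j j'))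
    simpa [Pi.single_apply] using this
  · have := hfirst (Pi.single j 1) 0 (fun j' => add_nonneg (hσ j') (hsingle j j'))
      (fun j' => by simpa using hσ' j')
    simp [Pi.single_apply] at this
    linarith

/-- The softmax prediction at a dual maximizer minimizes `z · log g` over the polytope. -/
lemma dotlog_gexp_self_le {n k p : ℕ} (hk : 0 < k) (h : Fin p → Fin n → Option (Fin k))
    (b ε : Fin p ⊕ Fin k → ℝ)
    (σ σ' : Fin p ⊕ Fin k → ℝ) (hσ : ∀ j, 0 ≤ σ j) (hσ' : ∀ j, 0 ≤ σ' j)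
    (hopt : ∀ τ τ' : Fin p ⊕ Fin k → ℝ, (∀ j, 0 ≤ τ j) → (∀ j, 0 ≤ τ' j) →
      dualObj h b ε τ τ' ≤ dualObj h b ε σ σ')
    {z : Fin n → Fin k → ℝ} (hz : z ∈ Polytope h b ε) :
    dotlog (gexp h (fun j => σ' j - σ j)) (gexp h (fun j => σ' j - σ j))
      ≤ dotlog z (gexp h (fun j => σ' j - σ j)) := by
  rw [dotlog_gexp hk h _ hz.1, dotlog_gexp hk h _ (gexp_mem_simplex hk h _),
    EReal.coe_le_coe_iff]
  refine sub_le_sub_right ?_ _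
  set g := gexp h (fun j => σ' j - σ j)
  have hslack : ∑ j, (-σ' j - -σ j) * b j - ∑ j, (-σ' j + -σ j) * ε j
      ≤ ∑ j, (-σ' j - -σ j) * applyA h g j :=
    dualObj_first_order hk h b ε σ σ' hσ hσ' hopt (fun j => -σ j) (fun j => -σ' j)
      (fun j => by simp) (fun j => by simp)
  have hweak : ∑ j, (σ' j * (b j - ε j) - σ j * (b j + ε j))
      ≤ ∑ j, (σ' j - σ j) * applyA h z j := Finset.sum_le_sum fun j _ => by
    have h1 := mul_le_mul_of_nonneg_left (hz.2 j).1 (hσ' j)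
    have h2 := mul_le_mul_of_nonneg_left (hz.2 j).2 (hσ j)
    linarith
  refine le_trans ?_ hweak
  rw [← sub_nonneg] at hslack ⊢
  simp only [← Finset.sum_sub_distrib] at hslack ⊢
  exact hslack.trans_eq (Finset.sum_congr rfl fun j _ => by ring)

/-- dual optimizers give an optimal learner play via the softmax prediction. -/
theorem stmt2 {n k p : ℕ} (hn : 0 < n) (hk : 2 ≤ k) (hp : 0 < p)
    (h : Fin p → Fin n → Option (Fin k)) (hnj : ∀ j, 0 < nRule h j)
    (η : Fin n → Fin k → ℝ) (b ε : Fin p ⊕ Fin k → ℝ)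
    (hε : ∀ j, 0 ≤ ε j) (hmem : η ∈ Polytope h b ε)
    (σ σ' : Fin p ⊕ Fin k → ℝ) (hσ : ∀ j, 0 ≤ σ j) (hσ' : ∀ j, 0 ≤ σ' j)
    (hopt : ∀ τ τ' : Fin p ⊕ Fin k → ℝ, (∀ j, 0 ≤ τ j) → (∀ j, 0 ≤ τ' j) →
      dualObj h b ε τ τ' ≤ dualObj h b ε σ σ') :
    (⨅ z ∈ Polytope h b ε, dotlog z (gexp h (fun j => σ' j - σ j)))
        = (⨅ z ∈ Polytope h b ε, dotlog z z)
    ∧ (⨅ z ∈ Polytope h b ε, dotlog z z)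
        = ⨆ g ∈ Simplex n k, ⨅ z ∈ Polytope h b ε, dotlog z g := by
  have hk0 : 0 < k := by omega
  set g := gexp h (fun j => σ' j - σ j)
  have hgP : g ∈ Polytope h b ε := gexp_mem_polytope hk0 h b ε σ σ' hσ hσ' hopt
  have hmin : ∀ z ∈ Polytope h b ε, dotlog g g ≤ dotlog z g := fun z hz =>
    dotlog_gexp_self_le hk0 h b ε σ σ' hσ hσ' hopt hz
  have hleft : (⨅ z ∈ Polytope h b ε, dotlog z g) = dotlog g g :=
    le_antisymm (iInf₂_le g hgP) (le_iInf₂ hmin)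
  have hmid : (⨅ z ∈ Polytope h b ε, dotlog z z) = dotlog g g :=
    le_antisymm (iInf₂_le g hgP) (le_iInf₂ fun z hz =>
      (hmin z hz).trans (dotlog_le_dotlog_self hz.1 hgP.1))
  refine ⟨hleft.trans hmid.symm, hmid.trans (le_antisymm ?_ ?_)⟩
  · exact hleft.symm.le.trans
      (le_iSup₂ (f := fun g' (_ : g' ∈ Simplex n k) => ⨅ z ∈ Polytope h b ε, dotlog z g') g hgP.1)
  · exact iSup₂_le fun g' hg' =>
      (iInf₂_le g hgP).trans (dotlog_le_dotlog_self hgP.1 hg')
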